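/- arXiv:2308.01768 — 2 statements merged into one kernel-verified Lean document; each statement's English description precedes it below -/
import Mathlib

section
/- For every n ≥ 1 and every a ∈ ℝ^n, the Toeplitz-plus-Hankel matrix Th(a) is diagonalized by the discrete cosine transform: Th(a) = C̄ᵀ · diag(ā) · C̄, where ā = diag(c₁)·C̄·(Γ·a). -/
open Matrix

/-- The discrete cosine transform matrix `C̄`. -/
noncomputable def dctBar (n : ℕ) : Matrix (Fin n) (Fin n) ℝ :=
  fun i j => Real.sqrt ((2 - if i.val = 0 then 1 else 0) / n) *
    Real.cos ((i.val : ℝ) * (2 * (j.val : ℝ) + 1) * Real.pi / (2 * n))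

/-- The vector `c₁ ∈ ℝ^n` with `c₁[i] = 1/C̄[i,1]`. -/
noncomputable def cOne (n : ℕ) (hn : 1 ≤ n) : Fin n → ℝ :=
  fun i => 1 / dctBar n i ⟨0, hn⟩

/-- The Toeplitz-plus-Hankel matrix `Th(a) ∈ ℝ^{n×n}` (1-based formula):
`Th(a)[i,j] = a[|i−j|+1] + (1 − δ_{i+j,n+1})·b_{ij}`, where `b_{ij} = a[i+j]`
if `i+j ≤ n` and `b_{ij} = a[2(n+1)−(i+j)]` if `i+j > n`.
Indices `i j : Fin n` correspond to 1-based indices `i.val+1`, `j.val+1`. -/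
noncomputable def thMat {n : ℕ} (a : Fin n → ℝ) : Matrix (Fin n) (Fin n) ℝ :=
  fun i j =>
    a ⟨i.val - j.val + (j.val - i.val), by have := i.isLt; have := j.isLt; omega⟩ +
    if hd : i.val + j.val + 1 = n then 0
    else if hle : i.val + j.val + 2 ≤ n then a ⟨i.val + j.val + 1, by omega⟩
    else a ⟨2 * n - 1 - (i.val + j.val), by have := i.isLt; have := j.isLt; omega⟩

/-- The unit upper bidiagonal matrix `Γ ∈ ℝ^{n×n}` with `Γ[i,i] = 1`,
`Γ[i,i+1] = 1` for `i < n`, and all other entries `0`. -/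
def gammaMat (n : ℕ) : Matrix (Fin n) (Fin n) ℝ :=
  fun i j => if j.val = i.val then 1 else if j.val = i.val + 1 then 1 else 0

/-- The Dirichlet kernel identity, in product form. -/
lemma sum_range_cos_mul_sin_half (x : ℝ) (n : ℕ) :
    (∑ k ∈ Finset.range (n + 1), (if k = 0 then 1 else 2) * Real.cos (k * x)) *
      Real.sin (x / 2) = Real.sin ((2 * n + 1) * x / 2) := by
  induction n with
  | zero => simp
  | succ n ih =>
    rw [Finset.sum_range_succ, add_mul, ih, if_neg n.succ_ne_zero]
    have h₁ : (2 * (n : ℝ) + 1) * x / 2 = (n + 1) * x - x / 2 := by ring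
    have h₂ : (2 * ((n : ℝ) + 1) + 1) * x / 2 = (n + 1) * x + x / 2 := by ring
    push_cast
    rw [h₁, h₂, Real.sin_sub, Real.sin_add]
    ring

/-- The Dirichlet kernel at the multiples of `π / n`. -/
lemma sum_range_cos_mul_pi_div (n : ℕ) (hn : 1 ≤ n) (p : ℤ) :
    ∑ k ∈ Finset.range n, (if k = 0 then 1 else 2) * Real.cos (k * (p * Real.pi / n)) =
      (if 2 * (n : ℤ) ∣ p then 2 * (n : ℝ) else 0) - (-1) ^ p := by
  obtain ⟨n, rfl⟩ := Nat.exists_eq_add_of_le' hn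
  have hn₀ : ((n + 1 : ℕ) : ℝ) ≠ 0 := by positivity
  split_ifs with h
  · obtain ⟨q, rfl⟩ := h
    have hcos (k : ℕ) :
        Real.cos (k * ((2 * ((n + 1 : ℕ) : ℤ) * q : ℤ) * Real.pi / (n + 1 : ℕ))) = 1 := by
      rw [Real.cos_eq_one_iff]
      refine ⟨k * q, ?_⟩
      push_cast at hn₀ ⊢
      field_simp
    simp only [hcos, mul_one]
    rw [Finset.sum_range_succ', mul_assoc, _root_.zpow_mul]
    simp
    ring
  · have hsin : Real.sin (p * Real.pi / (n + 1 : ℕ) / 2) ≠ 0 := by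
      rw [Real.sin_ne_zero_iff]
      intro m hm
      apply h
      refine ⟨m, ?_⟩
      field_simp at hm
      have hm' : (p : ℝ) = 2 * (n + 1 : ℕ) * m := by linarith
      exact_mod_cast hm'
    refine mul_right_cancel₀ hsin ?_
    rw [sum_range_cos_mul_sin_half]
    have harg : (2 * (n : ℝ) + 1) * (p * Real.pi / (n + 1 : ℕ)) / 2 =
        p * Real.pi - p * Real.pi / (n + 1 : ℕ) / 2 := by
      push_cast at hn₀ ⊢
      field_simp
      ring
    rw [harg, Real.sin_sub, Real.sin_int_mul_pi, Real.cos_int_mul_pi]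
    ring

lemma dctBar_apply_zero_ne_zero (n : ℕ) (hn : 1 ≤ n) (k : Fin n) : dctBar n k ⟨0, hn⟩ ≠ 0 := by
  have hn₀ : (0 : ℝ) < n := by exact_mod_cast hn
  have hk : (k.val : ℝ) < n := by exact_mod_cast k.isLt
  refine mul_ne_zero (Real.sqrt_ne_zero'.2 (div_pos ?_ hn₀)) (Real.cos_pos_of_mem_Ioo ⟨?_, ?_⟩).ne'
  · split_ifs <;> norm_num
  · have : (0 : ℝ) ≤ k.val * (2 * ((0 : ℕ) : ℝ) + 1) * Real.pi / (2 * n) := by positivity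
    exact (neg_lt_zero.2 Real.pi_div_two_pos).trans_le this
  · rw [div_lt_div_iff₀ (by positivity) two_pos]
    have := mul_lt_mul_of_pos_right hk Real.pi_pos
    simp only [Nat.cast_zero]
    nlinarith

lemma dctBar_mul_dctBar (n : ℕ) (k i j : Fin n) :
    dctBar n k i * dctBar n k j = (if k.val = 0 then 1 else 2) / (2 * n) *
      (Real.cos (k.val * (((i.val : ℤ) - j.val : ℤ) * Real.pi / n)) +
        Real.cos (k.val * (((i.val : ℤ) + j.val + 1 : ℤ) * Real.pi / n))) := by
  have hn₀ : (n : ℝ) ≠ 0 := by exact_mod_cast (k.pos).ne'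
  have hp : k.val * (((i.val : ℤ) - j.val : ℤ) * Real.pi / n) =
      k.val * (2 * (i.val : ℝ) + 1) * Real.pi / (2 * n) -
        k.val * (2 * (j.val : ℝ) + 1) * Real.pi / (2 * n) := by
    push_cast
    field_simp
    ring
  have hq : k.val * (((i.val : ℤ) + j.val + 1 : ℤ) * Real.pi / n) =
      k.val * (2 * (i.val : ℝ) + 1) * Real.pi / (2 * n) +
        k.val * (2 * (j.val : ℝ) + 1) * Real.pi / (2 * n) := by
    push_cast
    field_simp
    ring
  have hw : (0 : ℝ) ≤ (2 - if k.val = 0 then 1 else 0) / n := by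
    refine div_nonneg ?_ n.cast_nonneg
    split_ifs <;> norm_num
  have hw' : (2 - if k.val = 0 then 1 else 0 : ℝ) = if k.val = 0 then 1 else 2 := by
    split_ifs <;> norm_num
  rw [hp, hq, Real.cos_sub, Real.cos_add, dctBar, dctBar, mul_mul_mul_comm,
    Real.mul_self_sqrt hw, hw']
  field_simp
  ring

/-- The columns of `C̄ Γ`, relative to the first column of `C̄`. -/
lemma dctBar_mul_gammaMat_apply (n : ℕ) (hn : 1 ≤ n) (k l : Fin n) :
    (dctBar n * gammaMat n) k l = dctBar n k ⟨0, hn⟩ *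
      (if l.val = 0 then 1 else 2 * Real.cos (k.val * ((l.val : ℤ) * Real.pi / n))) := by
  have hn₀ : (n : ℝ) ≠ 0 := by exact_mod_cast (k.pos).ne'
  obtain ⟨l, hl⟩ := l
  rw [Matrix.mul_apply]
  cases l with
  | zero =>
    rw [Finset.sum_eq_single ⟨0, hn⟩]
    · simp [gammaMat]
    · intro m _ hm
      have : (0 : ℕ) ≠ m.val := fun h => hm (Fin.ext h.symm)
      simp [gammaMat, this]
    · simp
  | succ l =>
    have hsplit (m : Fin n) : gammaMat n m ⟨l + 1, hl⟩ =
        (if m = ⟨l + 1, hl⟩ then 1 else 0) + (if m = ⟨l, by omega⟩ then 1 else 0) := by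
      simp only [gammaMat, Fin.ext_iff]
      grind
    simp only [hsplit, mul_add, mul_ite, mul_one, mul_zero, Finset.sum_add_distrib,
      Finset.sum_ite_eq', Finset.mem_univ, if_true, Nat.succ_ne_zero, if_false]
    have h₁ : k.val * (2 * ((l + 1 : ℕ) : ℝ) + 1) * Real.pi / (2 * n) =
        k.val * (((l + 1 : ℕ) : ℤ) * Real.pi / n) +
          k.val * (2 * ((0 : ℕ) : ℝ) + 1) * Real.pi / (2 * n) := by
      push_cast
      field_simp
      ring
    have h₂ : k.val * (2 * (l : ℝ) + 1) * Real.pi / (2 * n) =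
        k.val * (((l + 1 : ℕ) : ℤ) * Real.pi / n) -
          k.val * (2 * ((0 : ℕ) : ℝ) + 1) * Real.pi / (2 * n) := by
      push_cast
      field_simp
      ring
    simp only [dctBar]
    rw [h₁, h₂, Real.cos_add, Real.cos_sub]
    ring

lemma diagonal_cOne_mul_dctBar_mulVec (n : ℕ) (hn : 1 ≤ n) (a : Fin n → ℝ) (k : Fin n) :
    ((Matrix.diagonal (cOne n hn) * dctBar n) *ᵥ (gammaMat n *ᵥ a)) k =
      ∑ l : Fin n,
        (if l.val = 0 then 1 else 2 * Real.cos (k.val * ((l.val : ℤ) * Real.pi / n))) * a l := by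
  rw [Matrix.mulVec_mulVec, Matrix.mul_assoc]
  simp only [Matrix.mulVec, dotProduct]
  refine Finset.sum_congr rfl fun l _ => congrArg (· * a l) ?_
  rw [Matrix.diagonal_mul, dctBar_mul_gammaMat_apply n hn, cOne, ← mul_assoc, one_div,
    inv_mul_cancel₀ (dctBar_apply_zero_ne_zero n hn k), one_mul]

lemma two_mul_cos_mul_cos_int (n k : ℕ) (p m : ℤ) :
    2 * Real.cos (k * (p * Real.pi / n)) * Real.cos (k * (m * Real.pi / n)) =
      Real.cos (k * ((p - m : ℤ) * Real.pi / n)) + Real.cos (k * ((p + m : ℤ) * Real.pi / n)) := by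
  rw [Real.two_mul_cos_mul_cos]
  push_cast
  congr 2 <;> ring

/-- The entries of `Th(e_l)`, computed from the Dirichlet kernel. -/
lemma sum_dctBar_mul_dctBar_mul (n : ℕ) (i j l : Fin n) :
    ∑ k : Fin n, dctBar n k i * dctBar n k j *
      (if l.val = 0 then 1 else 2 * Real.cos (k.val * ((l.val : ℤ) * Real.pi / n))) =
    (if l.val = i.val - j.val + (j.val - i.val) then 1 else 0) +
      if i.val + j.val + 1 = n then 0
      else if i.val + j.val + 2 ≤ n then (if l.val = i.val + j.val + 1 then 1 else 0)
      else if l.val = 2 * n - 1 - (i.val + j.val) then 1 else 0 := by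
  have hn : 1 ≤ n := i.pos
  have hn₀ : (n : ℝ) ≠ 0 := by exact_mod_cast i.pos.ne'
  set D : ℤ → ℝ := fun p =>
    ∑ k ∈ Finset.range n, (if k = 0 then 1 else 2) * Real.cos (k * (p * Real.pi / n)) with hD
  have hpar (r : ℤ) : ((-1 : ℝ)) ^ ((i.val : ℤ) + j.val + 1 + r) =
      -(-1) ^ ((i.val : ℤ) - j.val + r) := by
    have : (i.val : ℤ) + j.val + 1 + r = ((i.val : ℤ) - j.val + r) + (2 * j.val + 1) := by ring
    rw [this, zpow_add₀ (by norm_num), Odd.neg_one_zpow ⟨_, rfl⟩]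
    ring
  have hpair (r : ℤ) : D ((i.val : ℤ) - j.val + r) + D ((i.val : ℤ) + j.val + 1 + r) =
      2 * n * ((if 2 * (n : ℤ) ∣ (i.val : ℤ) - j.val + r then 1 else 0) +
        if 2 * (n : ℤ) ∣ (i.val : ℤ) + j.val + 1 + r then 1 else 0) := by
    simp only [hD]
    rw [sum_range_cos_mul_pi_div n hn, sum_range_cos_mul_pi_div n hn, hpar]
    split_ifs <;> ring
  have hdvd (z : ℤ) (h₁ : -(2 * (n : ℤ)) < z) (h₂ : z < 4 * n) :
      2 * (n : ℤ) ∣ z ↔ z = 0 ∨ z = 2 * n := by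
    constructor
    · rintro ⟨c, rfl⟩
      have hc₁ : -1 < c := by nlinarith
      have hc₂ : c < 2 := by nlinarith
      obtain rfl | rfl : c = 0 ∨ c = 1 := by omega
      · simp
      · simp
    · rintro (rfl | rfl) <;> simp
  have hi := i.isLt
  have hj := j.isLt
  have hl := l.isLt
  by_cases h₀ : l.val = 0
  · have hsum : ∑ k : Fin n, dctBar n k i * dctBar n k j = 1 / (2 * n) *
        (D ((i.val : ℤ) - j.val + 0) + D ((i.val : ℤ) + j.val + 1 + 0)) := by
      simp only [hD, add_zero]
      rw [← Finset.sum_add_distrib, Finset.mul_sum, ← Fin.sum_univ_eq_sum_range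
        (fun k : ℕ => 1 / (2 * (n : ℝ)) *
          ((if k = 0 then 1 else 2) * Real.cos (k * (((i.val : ℤ) - j.val : ℤ) * Real.pi / n)) +
          (if k = 0 then 1 else 2) *
            Real.cos (k * (((i.val : ℤ) + j.val + 1 : ℤ) * Real.pi / n))))]
      refine Finset.sum_congr rfl fun k _ => ?_
      rw [dctBar_mul_dctBar]
      ring
    simp only [h₀, if_true, mul_one]
    rw [hsum, hpair, ← mul_assoc, one_div_mul_cancel (by positivity), one_mul]
    simp only [hdvd ((i.val : ℤ) - j.val + 0) (by omega) (by omega),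
      hdvd ((i.val : ℤ) + j.val + 1 + 0) (by omega) (by omega)]
    split_ifs <;> first | omega | contradiction | norm_num
  · have hsum : ∑ k : Fin n, dctBar n k i * dctBar n k j *
        (2 * Real.cos (k.val * ((l.val : ℤ) * Real.pi / n))) = 1 / (2 * n) *
        ((D ((i.val : ℤ) - j.val + -l.val) + D ((i.val : ℤ) + j.val + 1 + -l.val)) +
          (D ((i.val : ℤ) - j.val + l.val) + D ((i.val : ℤ) + j.val + 1 + l.val))) := by
      simp only [hD]
      rw [← Finset.sum_add_distrib, ← Finset.sum_add_distrib, ← Finset.sum_add_distrib,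
        Finset.mul_sum, Finset.sum_range]
      refine Finset.sum_congr rfl fun k _ => ?_
      have hp := two_mul_cos_mul_cos_int n k ((i.val : ℤ) - j.val) l.val
      have hq := two_mul_cos_mul_cos_int n k ((i.val : ℤ) + j.val + 1) l.val
      rw [sub_eq_add_neg _ (l.val : ℤ)] at hp hq
      rw [dctBar_mul_dctBar]
      linear_combination (if k.val = 0 then 1 else 2) / (2 * (n : ℝ)) * (hp + hq)
    simp only [h₀, if_false]
    rw [hsum, hpair, hpair, ← mul_add, ← mul_assoc, one_div_mul_cancel (by positivity), one_mul]
    have hToeplitz : (if 2 * (n : ℤ) ∣ (i.val : ℤ) - j.val + -l.val then (1 : ℝ) else 0) +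
        (if 2 * (n : ℤ) ∣ (i.val : ℤ) - j.val + l.val then 1 else 0) =
        if l.val = i.val - j.val + (j.val - i.val) then 1 else 0 := by
      simp only [hdvd ((i.val : ℤ) - j.val + -l.val) (by omega) (by omega),
        hdvd ((i.val : ℤ) - j.val + l.val) (by omega) (by omega)]
      split_ifs <;> first | omega | norm_num
    have hHankel : (if 2 * (n : ℤ) ∣ (i.val : ℤ) + j.val + 1 + -l.val then (1 : ℝ) else 0) +
        (if 2 * (n : ℤ) ∣ (i.val : ℤ) + j.val + 1 + l.val then 1 else 0) =
        if i.val + j.val + 1 = n then 0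
        else if i.val + j.val + 2 ≤ n then (if l.val = i.val + j.val + 1 then 1 else 0)
        else if l.val = 2 * n - 1 - (i.val + j.val) then 1 else 0 := by
      simp only [hdvd ((i.val : ℤ) + j.val + 1 + -l.val) (by omega) (by omega),
        hdvd ((i.val : ℤ) + j.val + 1 + l.val) (by omega) (by omega)]
      split_ifs <;> first | omega | norm_num
    rw [← hToeplitz, ← hHankel]
    ring

lemma thMat_apply_eq_sum {n : ℕ} (a : Fin n → ℝ) (i j : Fin n) :
    thMat a i j = ∑ l : Fin n,
      ((if l.val = i.val - j.val + (j.val - i.val) then 1 else 0) +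
        if i.val + j.val + 1 = n then 0
        else if i.val + j.val + 2 ≤ n then (if l.val = i.val + j.val + 1 then 1 else 0)
        else if l.val = 2 * n - 1 - (i.val + j.val) then 1 else 0) * a l := by
  have hsum (m : ℕ) (hm : m < n) :
      a ⟨m, hm⟩ = ∑ l : Fin n, (if l.val = m then 1 else 0) * a l := by
    rw [Finset.sum_eq_single ⟨m, hm⟩] <;> simp +contextual [Fin.ext_iff]
  simp only [add_mul, Finset.sum_add_distrib]
  rw [thMat, ← hsum _ (by omega)]
  congr 1
  split_ifs
  · simp
  · exact hsum _ _
  · exact hsum _ _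

/-- For every `n ≥ 1` and every `a ∈ ℝ^n`, `Th(a) = C̄ᵀ·diag(ā)·C̄`,
where `ā = diag(c₁)·C̄·(Γ·a)`. -/
theorem thMat_eq_dct_diag_dct (n : ℕ) (hn : 1 ≤ n) (a : Fin n → ℝ) :
    thMat a =
      (dctBar n)ᵀ *
        Matrix.diagonal ((Matrix.diagonal (cOne n hn) * dctBar n) *ᵥ (gammaMat n *ᵥ a)) *
        dctBar n := by
  ext i j
  rw [thMat_apply_eq_sum, Matrix.mul_apply]
  simp only [Matrix.mul_diagonal, Matrix.transpose_apply, diagonal_cOne_mul_dctBar_mulVec,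
    ← sum_dctBar_mul_dctBar_mul, Finset.sum_mul, Finset.mul_sum]
  rw [Finset.sum_comm]
  refine Finset.sum_congr rfl fun k _ => Finset.sum_congr rfl fun l _ => ?_
  ring
end

section
/- Diagonalization of the {2,4}-Toeplitz-plus-Hankel tensor: let A ∈ ℝ^{n1×n2×n3}, let Â be obtained by applying Γ^{−1} along mode 2 of A (i.e., Â[i1,:,i3] = Γ^{−1}·A[i1,:,i3]), and define the 4-order tensor TH(Â) ∈ ℝ^{n1×n2×n3×n2} by TH(Â)[i1,:,i3,:] = Th(Â[i1,:,i3]). Then for all i1, i3, TH(Â)[i1,:,i3,:] = C^{−1}·diag(Ā[i1,:,i3])·C, where Ā = (C)₂.A; equivalently, TH(Â)[i1,i2,i3,i4] = Σ_{k=1}^{n2} C^{−1}[i2,k]·Ā[i1,k,i3]·C[k,i4]. -/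
open Matrix

/-- The matrix `C = diag(c₁)·C̄`. -/
noncomputable def Cmat (n : ℕ) (hn : 1 ≤ n) : Matrix (Fin n) (Fin n) ℝ :=
  Matrix.diagonal (cOne n hn) * dctBar n

/-- The angle `kπ/(2n)` attached to the `k`-th row of the cosine transform. -/
noncomputable def dctAngle (n k : ℕ) : ℝ := k * Real.pi / (2 * n)

/-- The `m`-th basis eigenvalue `1` (for `m = 0`) or `2 cos(2mφ)` of the Toeplitz-plus-Hankel
algebra. -/
noncomputable def thWeight (φ : ℝ) (m : ℕ) : ℝ := if m = 0 then 1 else 2 * Real.cos (2 * m * φ)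

lemma sin_dctAngle_ne_zero {n m : ℕ} (hm : 0 < m) (hmn : m < 2 * n) :
    Real.sin (dctAngle n m) ≠ 0 := by
  have hn : (0 : ℝ) < n := by exact_mod_cast (by omega : 0 < n)
  have hm' : (0 : ℝ) < m := by exact_mod_cast hm
  have hmn' : (m : ℝ) < 2 * n := by exact_mod_cast hmn
  refine (Real.sin_pos_of_pos_of_lt_pi ?_ ?_).ne'
  · unfold dctAngle; positivity
  · rw [dctAngle, div_lt_iff₀ (by positivity), mul_comm Real.pi]
    exact mul_lt_mul_of_pos_right hmn' Real.pi_pos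

lemma cos_dctAngle_pos {n k : ℕ} (hk : k < n) : 0 < Real.cos (dctAngle n k) := by
  have hn : (0 : ℝ) < n := by exact_mod_cast (by omega : 0 < n)
  have hk' : (k : ℝ) < n := by exact_mod_cast hk
  have h0 : 0 ≤ dctAngle n k := by unfold dctAngle; positivity
  refine Real.cos_pos_of_mem_Ioo ⟨by linarith [Real.pi_pos], ?_⟩
  rw [dctAngle, div_lt_iff₀ (by positivity)]
  nlinarith [Real.pi_pos]

lemma two_mul_sin_mul_sum_cos_odd (φ : ℝ) (n : ℕ) :
    2 * Real.sin φ * ∑ j ∈ Finset.range n, Real.cos ((2 * j + 1) * φ) =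
      Real.sin (2 * n * φ) := by
  induction n with
  | zero => simp
  | succ n ih =>
    rw [Finset.sum_range_succ, mul_add, ih]
    have h1 : (2 * (n : ℝ)) * φ = (2 * n + 1) * φ - φ := by ring
    have h2 : (2 * ((n + 1 : ℕ) : ℝ)) * φ = (2 * n + 1) * φ + φ := by push_cast; ring
    rw [h1, h2, Real.sin_sub, Real.sin_add]
    ring

lemma sum_cos_odd_mul_dctAngle {n m : ℕ} (hm : 0 < m) (hmn : m < 2 * n) :
    ∑ j : Fin n, Real.cos ((2 * (j : ℕ) + 1) * dctAngle n m) = 0 := by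
  rw [Fin.sum_univ_eq_sum_range (fun j : ℕ => Real.cos ((2 * (j : ℝ) + 1) * dctAngle n m))]
  have hn : (n : ℝ) ≠ 0 := by exact_mod_cast (by omega : n ≠ 0)
  have h := two_mul_sin_mul_sum_cos_odd (dctAngle n m) n
  have h' : 2 * (n : ℝ) * dctAngle n m = m * Real.pi := by unfold dctAngle; field_simp
  rw [h', Real.sin_nat_mul_pi] at h
  exact (mul_eq_zero.mp h).resolve_left
    (mul_ne_zero two_ne_zero (sin_dctAngle_ne_zero hm hmn))

lemma dctBar_apply (n : ℕ) (k j : Fin n) :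
    dctBar n k j = Real.sqrt ((2 - if k.val = 0 then 1 else 0) / n) *
      Real.cos ((2 * (j : ℕ) + 1) * dctAngle n k) := by
  unfold dctBar dctAngle
  congr 2
  ring

lemma two_mul_sum_cos_odd_mul_cos_odd {n : ℕ} {k l : ℕ} (hlk : l ≤ k) :
    2 * ∑ j : Fin n, Real.cos ((2 * (j : ℕ) + 1) * dctAngle n k) *
        Real.cos ((2 * (j : ℕ) + 1) * dctAngle n l) =
      ∑ j : Fin n, Real.cos ((2 * (j : ℕ) + 1) * dctAngle n (k - l)) +
        ∑ j : Fin n, Real.cos ((2 * (j : ℕ) + 1) * dctAngle n (k + l)) := by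
  rw [Finset.mul_sum, ← Finset.sum_add_distrib]
  refine Finset.sum_congr rfl fun j _ => ?_
  have h1 : (2 * ((j : ℕ) : ℝ) + 1) * dctAngle n (k - l) =
      (2 * ((j : ℕ) : ℝ) + 1) * dctAngle n k - (2 * ((j : ℕ) : ℝ) + 1) * dctAngle n l := by
    unfold dctAngle; rw [Nat.cast_sub hlk]; ring
  have h2 : (2 * ((j : ℕ) : ℝ) + 1) * dctAngle n (k + l) =
      (2 * ((j : ℕ) : ℝ) + 1) * dctAngle n k + (2 * ((j : ℕ) : ℝ) + 1) * dctAngle n l := by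
    unfold dctAngle; push_cast; ring
  rw [h1, h2, Real.cos_sub, Real.cos_add]
  ring

lemma sum_cos_odd_mul_cos_odd_of_lt {n k l : ℕ} (hlk : l < k) (hk : k < n) :
    ∑ j : Fin n, Real.cos ((2 * (j : ℕ) + 1) * dctAngle n k) *
        Real.cos ((2 * (j : ℕ) + 1) * dctAngle n l) = 0 := by
  have h := two_mul_sum_cos_odd_mul_cos_odd (n := n) hlk.le
  rw [sum_cos_odd_mul_dctAngle (by omega) (by omega),
    sum_cos_odd_mul_dctAngle (by omega) (by omega)] at h
  linarith

lemma sum_cos_odd_sq_pos {n : ℕ} (k : Fin n) :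
    0 < ∑ j : Fin n, Real.cos ((2 * (j : ℕ) + 1) * dctAngle n k) *
        Real.cos ((2 * (j : ℕ) + 1) * dctAngle n k) := by
  have hn : 0 < n := k.pos
  refine Finset.sum_pos' (fun j _ => mul_self_nonneg _) ⟨⟨0, hn⟩, Finset.mem_univ _, ?_⟩
  have h := cos_dctAngle_pos k.isLt
  simpa using mul_pos h h

lemma sqrt_dct_coeff_pos {n : ℕ} (k : Fin n) :
    0 < Real.sqrt ((2 - if k.val = 0 then 1 else 0) / n) := by
  have hn : (0 : ℝ) < n := by exact_mod_cast k.pos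
  refine Real.sqrt_pos.mpr (div_pos ?_ hn)
  split_ifs <;> norm_num

lemma Cmat_apply (n : ℕ) (hn : 1 ≤ n) (k j : Fin n) :
    Cmat n hn k j =
      Real.cos ((2 * (j : ℕ) + 1) * dctAngle n k) / Real.cos (dctAngle n k) := by
  have hs := (sqrt_dct_coeff_pos k).ne'
  have hc := (cos_dctAngle_pos k.isLt).ne'
  rw [Cmat, Matrix.diagonal_mul, cOne, dctBar_apply, dctBar_apply]
  simp only [Nat.cast_zero, mul_zero, zero_add, one_mul]
  field_simp

lemma Cmat_mul_transpose (n : ℕ) (hn : 1 ≤ n) :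
    ∃ d : Fin n → ℝ, (∀ k, d k ≠ 0) ∧ Cmat n hn * (Cmat n hn)ᵀ = Matrix.diagonal d := by
  refine ⟨fun k => (∑ j : Fin n, Real.cos ((2 * (j : ℕ) + 1) * dctAngle n k) *
        Real.cos ((2 * (j : ℕ) + 1) * dctAngle n k)) /
        (Real.cos (dctAngle n k) * Real.cos (dctAngle n k)), fun k => ?_, ?_⟩
  · have h := cos_dctAngle_pos k.isLt
    exact (div_pos (sum_cos_odd_sq_pos k) (mul_pos h h)).ne'
  · ext k l
    simp only [Matrix.mul_apply, Matrix.transpose_apply, Cmat_apply, div_mul_div_comm,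
      ← Finset.sum_div]
    rcases lt_trichotomy l k with h | rfl | h
    · rw [Matrix.diagonal_apply_ne _ h.ne', sum_cos_odd_mul_cos_odd_of_lt h k.isLt, zero_div]
    · rw [Matrix.diagonal_apply_eq]
    · rw [Matrix.diagonal_apply_ne _ h.ne]
      simp only [mul_comm (Real.cos (_ * dctAngle n k))]
      rw [sum_cos_odd_mul_cos_odd_of_lt h l.isLt, zero_div]

lemma isUnit_det_Cmat (n : ℕ) (hn : 1 ≤ n) : IsUnit (Cmat n hn).det := by
  obtain ⟨d, hd, h⟩ := Cmat_mul_transpose n hn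
  have h' := congrArg Matrix.det h
  rw [Matrix.det_mul, Matrix.det_diagonal] at h'
  exact isUnit_iff_ne_zero.mpr
    (left_ne_zero_of_mul (h'.trans_ne (Finset.prod_ne_zero_iff.mpr fun k _ => hd k)))

lemma isUnit_det_gammaMat (n : ℕ) : IsUnit (gammaMat n).det := by
  have h : (gammaMat n).BlockTriangular id := by
    intro i j (hij : j < i)
    have : j.val < i.val := hij
    rw [gammaMat, if_neg (by omega), if_neg (by omega)]
  rw [Matrix.det_of_isUpperTriangular h]
  simp [gammaMat]

lemma sum_mul_eq_val_of_lt {n : ℕ} (u : ℕ → ℝ) {p : ℕ} (hp : p < n) :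
    ∑ i : Fin n, u i * (if i.val = p then 1 else 0) = u p := by
  rw [Finset.sum_eq_single ⟨p, hp⟩]
  · simp
  · intro i _ hi
    rw [if_neg fun h => hi (Fin.ext h), mul_zero]
  · simp

lemma Cmat_mul_gammaMat_apply (n : ℕ) (hn : 1 ≤ n) (k m : Fin n) :
    (Cmat n hn * gammaMat n) k m = thWeight (dctAngle n k) m := by
  have hc := (cos_dctAngle_pos k.isLt).ne'
  simp only [Matrix.mul_apply, Cmat_apply]
  rcases Nat.eq_zero_or_pos m.val with hm | hm
  · have h : ∀ i : Fin n, gammaMat n i m = if i.val = 0 then 1 else 0 := by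
      intro i
      unfold gammaMat
      split_ifs <;> first | rfl | omega
    simp only [h]
    rw [sum_mul_eq_val_of_lt (fun i : ℕ => Real.cos ((2 * i + 1) * dctAngle n k) /
      Real.cos (dctAngle n k)) (by omega)]
    simp [thWeight, hm, hc]
  · have h : ∀ i : Fin n, gammaMat n i m =
        (if i.val = m.val then 1 else 0) + if i.val = m.val - 1 then 1 else 0 := by
      intro i
      unfold gammaMat
      split_ifs <;> first | omega | norm_num
    simp only [h, mul_add, Finset.sum_add_distrib]
    rw [sum_mul_eq_val_of_lt (fun i : ℕ => Real.cos ((2 * i + 1) * dctAngle n k) /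
        Real.cos (dctAngle n k)) m.isLt,
      sum_mul_eq_val_of_lt (fun i : ℕ => Real.cos ((2 * i + 1) * dctAngle n k) /
        Real.cos (dctAngle n k)) (by omega), thWeight, if_neg hm.ne', ← add_div, div_eq_iff hc]
    have h1 : (2 * (m.val : ℝ) + 1) * dctAngle n k = 2 * m.val * dctAngle n k + dctAngle n k := by
      ring
    have h2 : (2 * ((m.val - 1 : ℕ) : ℝ) + 1) * dctAngle n k =
        2 * m.val * dctAngle n k - dctAngle n k := by
      rw [Nat.cast_sub hm]; push_cast; ring
    rw [h1, h2, Real.cos_add, Real.cos_sub]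
    ring

/-- The coefficient of `a m` in `thMat a i j`. -/
def thCoeff (n m i j : ℕ) : ℝ :=
  (if i - j + (j - i) = m then 1 else 0) +
    if i + j + 1 = n then 0
    else if i + j + 2 ≤ n then if i + j + 1 = m then 1 else 0
    else if 2 * n - 1 - (i + j) = m then 1 else 0

lemma thMat_apply_eq_sum_s12 {n : ℕ} (a : Fin n → ℝ) (i j : Fin n) :
    thMat a i j = ∑ m : Fin n, thCoeff n m i j * a m := by
  have key : ∀ (p : ℕ) (hp : p < n),
      ∑ m : Fin n, (if p = m.val then 1 else 0) * a m = a ⟨p, hp⟩ := by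
    intro p hp
    rw [Finset.sum_eq_single ⟨p, hp⟩]
    · simp
    · intro m _ hm
      rw [if_neg fun h => hm (Fin.ext h.symm), zero_mul]
    · simp
  unfold thMat thCoeff
  simp only [add_mul, Finset.sum_add_distrib]
  congr 1
  · rw [key]
  · split_ifs
    · simp
    · rw [key]
    · rw [key]

lemma thCoeff_eq_of_pos {n m i j : ℕ} (hm : 0 < m) (hmn : m < n) (hi : i < n) (hj : j < n) :
    thCoeff n m i j =
      (if i = (if j + m < n then j + m else 2 * n - 1 - (j + m)) then 1 else 0) +
        if i = (if m ≤ j then j - m else m - j - 1) then 1 else 0 := by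
  unfold thCoeff
  split_ifs <;> first | omega | norm_num

lemma cos_odd_reflect {n p : ℕ} (k : ℕ) (hp : p < 2 * n) :
    Real.cos ((2 * ((2 * n - 1 - p : ℕ) : ℝ) + 1) * dctAngle n k) =
      Real.cos ((2 * p + 1) * dctAngle n k) := by
  have hn : (n : ℝ) ≠ 0 := by exact_mod_cast (by omega : n ≠ 0)
  have h : (2 * ((2 * n - 1 - p : ℕ) : ℝ) + 1) * dctAngle n k =
      k * (2 * Real.pi) - (2 * p + 1) * dctAngle n k := by
    rw [Nat.sub_sub, Nat.cast_sub (by omega)]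
    unfold dctAngle
    push_cast
    field_simp
    ring
  rw [h, Real.cos_nat_mul_two_pi_sub]

lemma sum_cos_odd_mul_thCoeff {n : ℕ} (k : ℕ) (m j : Fin n) :
    ∑ i : Fin n, Real.cos ((2 * (i : ℕ) + 1) * dctAngle n k) * thCoeff n m i j =
      thWeight (dctAngle n k) m * Real.cos ((2 * (j : ℕ) + 1) * dctAngle n k) := by
  have hj := j.isLt
  have hmn := m.isLt
  rcases Nat.eq_zero_or_pos m.val with hm | hm
  · have h : ∀ i : Fin n, thCoeff n m i j = if i.val = j.val then 1 else 0 := by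
      intro i
      have hi := i.isLt
      unfold thCoeff
      split_ifs <;> first | omega | norm_num
    simp only [h]
    rw [sum_mul_eq_val_of_lt (fun i : ℕ => Real.cos ((2 * i + 1) * dctAngle n k)) hj]
    simp [thWeight, hm]
  · simp only [fun i : Fin n => thCoeff_eq_of_pos hm hmn i.isLt hj, mul_add,
      Finset.sum_add_distrib]
    rw [sum_mul_eq_val_of_lt (fun i : ℕ => Real.cos ((2 * i + 1) * dctAngle n k))
        (by split_ifs <;> omega),
      sum_mul_eq_val_of_lt (fun i : ℕ => Real.cos ((2 * i + 1) * dctAngle n k))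
        (by split_ifs <;> omega), thWeight, if_neg hm.ne']
    have h1 : Real.cos ((2 * ((if j.val + m.val < n then j.val + m.val
          else 2 * n - 1 - (j.val + m.val) : ℕ) : ℝ) + 1) * dctAngle n k) =
        Real.cos ((2 * j.val + 1) * dctAngle n k + 2 * m.val * dctAngle n k) := by
      have h : (2 * ((j.val + m.val : ℕ) : ℝ) + 1) * dctAngle n k =
          (2 * j.val + 1) * dctAngle n k + 2 * m.val * dctAngle n k := by
        push_cast; ring
      rw [← h]
      split_ifs
      · rfl
      · exact cos_odd_reflect k (by omega)
    have h2 : Real.cos ((2 * ((if m.val ≤ j.val then j.val - m.val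
          else m.val - j.val - 1 : ℕ) : ℝ) + 1) * dctAngle n k) =
        Real.cos ((2 * j.val + 1) * dctAngle n k - 2 * m.val * dctAngle n k) := by
      split_ifs with hmj
      · rw [Nat.cast_sub hmj]
        ring_nf
      · rw [Nat.sub_sub, Nat.cast_sub (by omega), ← Real.cos_neg]
        push_cast
        ring_nf
    rw [h1, h2, Real.cos_add, Real.cos_sub]
    ring

lemma Cmat_mul_thMat (n : ℕ) (hn : 1 ≤ n) (a : Fin n → ℝ) :
    Cmat n hn * thMat a =
      Matrix.diagonal (Cmat n hn *ᵥ (gammaMat n *ᵥ a)) * Cmat n hn := by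
  ext k j
  rw [Matrix.diagonal_mul, Matrix.mulVec_mulVec, Matrix.mulVec, dotProduct, Finset.sum_mul]
  simp only [Matrix.mul_apply (M := Cmat n hn) (N := thMat a), Cmat_mul_gammaMat_apply,
    Cmat_apply, thMat_apply_eq_sum_s12, Finset.mul_sum]
  rw [Finset.sum_comm]
  refine Finset.sum_congr rfl fun m _ => ?_
  calc _ = (∑ i : Fin n, Real.cos ((2 * (i : ℕ) + 1) * dctAngle n k) * thCoeff n m i j) *
        (a m / Real.cos (dctAngle n k)) := by
        rw [Finset.sum_mul]
        exact Finset.sum_congr rfl fun i _ => by ring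
    _ = _ := by
        rw [sum_cos_odd_mul_thCoeff]
        ring

/-- Diagonalization of the {2,4}-Toeplitz-plus-Hankel tensor: let
`A ∈ ℝ^{n1×n2×n3}`, `Â = (Γ⁻¹)₂.A` (i.e. `Â[i1,:,i3] = Γ⁻¹·A[i1,:,i3]`) and
`TH(Â)[i1,:,i3,:] = Th(Â[i1,:,i3])`. Then for all `i1, i3`,
`TH(Â)[i1,:,i3,:] = C⁻¹·diag(Ā[i1,:,i3])·C` where `Ā = (C)₂.A`. -/
theorem THtensor_diagonalization (n1 n2 n3 : ℕ) (hn : 1 ≤ n2)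
    (A : Fin n1 → Fin n2 → Fin n3 → ℝ) :
    ∀ (i1 : Fin n1) (i3 : Fin n3),
      thMat ((gammaMat n2)⁻¹ *ᵥ fun k => A i1 k i3) =
        (Cmat n2 hn)⁻¹ * Matrix.diagonal (Cmat n2 hn *ᵥ fun k => A i1 k i3) * Cmat n2 hn := by
  intro i1 i3
  have h := Cmat_mul_thMat n2 hn ((gammaMat n2)⁻¹ *ᵥ fun k => A i1 k i3)
  rw [Matrix.mulVec_mulVec (M := gammaMat n2), Matrix.mul_nonsing_inv _ (isUnit_det_gammaMat n2),
    Matrix.one_mulVec] at h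
  rw [Matrix.mul_assoc, ← h, Matrix.nonsing_inv_mul_cancel_left _ _ (isUnit_det_Cmat n2 hn)]
end
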